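/- Let $Q \in \mathbb{R}$ and let $f : [a,b] \to \mathbb{R}$ be a smooth function with $f > 0$ and $f' > 0$ on $[a,b]$, such that: (a) $1 - f'(s)^2 - 2 f(s) f''(s) > Q^2/f(s)^2$ for all $s \in [a,b]$; (b) $f(b) > |Q|$; and (c) $\tfrac{f(b)}{2}\big(1 + Q^2/f(b)^2 - f'(b)^2\big) \geq |Q|$. Then for every real number $m > \tfrac{f(b)}{2}\big(1 + Q^2/f(b)^2 - f'(b)^2\big)$ (note that then $m > |Q|$) there exist $c > b$ and a smooth function $\tilde f : [a,\infty) \to \mathbb{R}$ such that: (A) $\tilde f = f$ on $[a,b]$; (B) $\tilde f > 0$ and $\tilde f' > 0$ on $[a,\infty)$; (C) $1 - \tilde f'(s)^2 - 2 \tilde f(s) \tilde f''(s) \geq Q^2/\tilde f(s)^2$ for all $s \in [a,\infty)$; and (D) for all $s \geq c$ one has $\tilde f(s) > m + \sqrt{m^2 - Q^2}$ and $\tilde f'(s) = \sqrt{1 - 2m/\tilde f(s) + Q^2/\tilde f(s)^2}$. -/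

import Mathlib

open Set

/-- A smooth function with compact support all of whose derivatives at `0` are those of
`t ^ n / n !`. -/
theorem exists_contDiff_hasCompactSupport_iteratedDeriv_zero (n : ℕ) :
    ∃ φ : ℝ → ℝ, ContDiff ℝ (⊤ : ℕ∞) φ ∧ HasCompactSupport φ ∧
      ∀ k, iteratedDeriv k φ 0 = if k = n then 1 else 0 := by
  refine ⟨fun t => (n.factorial : ℝ)⁻¹ * t ^ n * Real.smoothTransition (2 - t ^ 2), ?_, ?_, ?_⟩
  · exact (contDiff_const.mul (contDiff_id.pow n)).mul
      (Real.smoothTransition.contDiff.comp (contDiff_const.sub (contDiff_id.pow 2)))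
  · refine HasCompactSupport.intro (isCompact_Icc (a := (-2 : ℝ)) (b := 2)) fun t ht => ?_
    have : 2 - t ^ 2 ≤ 0 := by
      by_contra! h
      exact ht ⟨by nlinarith, by nlinarith⟩
    simp [Real.smoothTransition.zero_of_nonpos this]
  · intro k
    have h : (fun t : ℝ => (n.factorial : ℝ)⁻¹ * t ^ n * Real.smoothTransition (2 - t ^ 2))
        =ᶠ[nhds 0] fun t => (n.factorial : ℝ)⁻¹ * t ^ n := by
      filter_upwards [Ioo_mem_nhds (show (-1 : ℝ) < 0 by norm_num) one_pos] with t ht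
      rw [Real.smoothTransition.one_of_one_le (by nlinarith [ht.1, ht.2]), mul_one]
    rw [h.iteratedDeriv_eq, iteratedDeriv_const_mul_field, iteratedDeriv_fun_pow_zero]
    have := Nat.factorial_ne_zero n
    split_ifs <;> simp_all

theorem exists_bound_iteratedDeriv_of_hasCompactSupport {φ : ℝ → ℝ}
    (hφ : ContDiff ℝ (⊤ : ℕ∞) φ) (hc : HasCompactSupport φ) (k : ℕ) :
    ∃ C : ℝ, ∀ t, |iteratedDeriv k φ t| ≤ C := by
  obtain ⟨C, hC⟩ := (hφ.continuous_iteratedFDeriv (m := k)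
    (by exact_mod_cast le_top)).bounded_above_of_compact_support (hc.iteratedFDeriv k)
  exact ⟨C, fun t => by simpa [norm_iteratedFDeriv_eq_norm_iteratedDeriv] using hC t⟩

/-- **Borel's lemma** in one variable. -/
theorem exists_contDiff_iteratedDeriv_eq (c : ℕ → ℝ) (x₀ : ℝ) :
    ∃ B : ℝ → ℝ, ContDiff ℝ (⊤ : ℕ∞) B ∧ ∀ k, iteratedDeriv k B x₀ = c k := by
  suffices H : ∃ B : ℝ → ℝ, ContDiff ℝ (⊤ : ℕ∞) B ∧ ∀ k, iteratedDeriv k B 0 = c k by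
    obtain ⟨B, hB, hB0⟩ := H
    refine ⟨fun t => B (t - x₀), hB.comp (contDiff_id.sub contDiff_const), fun k => ?_⟩
    simp [iteratedDeriv_comp_sub_const, hB0]
  choose φ hφ hφc hφ0 using exists_contDiff_hasCompactSupport_iteratedDeriv_zero
  choose C hC using fun n => exists_bound_iteratedDeriv_of_hasCompactSupport (hφ n) (hφc n)
  have hC0 : ∀ n k, 0 ≤ C n k := fun n k => (abs_nonneg _).trans (hC n k 0)
  set r : ℕ → ℝ := fun n => 1 + 2 ^ n * (|c n| * ∑ k ∈ Finset.range n, C n k) with hr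
  have hr1 : ∀ n, 1 ≤ r n := fun n => by
    have : 0 ≤ ∑ k ∈ Finset.range n, C n k := Finset.sum_nonneg fun k _ => hC0 n k
    simp only [hr]
    have : 0 ≤ 2 ^ n * (|c n| * ∑ k ∈ Finset.range n, C n k) := by positivity
    linarith
  have hr0 : ∀ n, 0 < r n := fun n => one_pos.trans_le (hr1 n)
  set u : ℕ → ℝ → ℝ := fun n t => c n * (r n)⁻¹ ^ n * φ n (r n * t) with hu
  have hcd : ∀ n, ContDiff ℝ (⊤ : ℕ∞) (u n) := fun n =>
    contDiff_const.mul ((hφ n).comp (contDiff_const.mul contDiff_id))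
  have hder : ∀ k n t, iteratedDeriv k (u n) t
      = c n * (r n)⁻¹ ^ n * (r n ^ k * iteratedDeriv k (φ n) (r n * t)) := fun k n t => by
    simp only [hu]
    rw [iteratedDeriv_const_mul_field, iteratedDeriv_comp_const_mul
      ((hφ n).of_le (by exact_mod_cast le_top))]
  set v : ℕ → ℕ → ℝ := fun k n =>
    if k < n then (1 / 2) ^ n else |c n| * (r n)⁻¹ ^ n * (r n ^ k * C n k) with hv
  have hbound : ∀ k n t, |iteratedDeriv k (u n) t| ≤ v k n := fun k n t => by
    have hrn := hr0 n
    have h1 : |iteratedDeriv k (u n) t| ≤ |c n| * (r n)⁻¹ ^ n * (r n ^ k * C n k) := by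
      rw [hder, abs_mul, abs_mul, abs_mul, abs_of_nonneg (show 0 ≤ (r n)⁻¹ ^ n by positivity),
        abs_of_nonneg (show 0 ≤ r n ^ k by positivity)]
      gcongr
      exact hC n k _
    simp only [hv]
    split_ifs with hkn
    · refine h1.trans ?_
      have h2 : (r n)⁻¹ ^ n * r n ^ k ≤ (r n)⁻¹ := by
        obtain ⟨j, rfl⟩ := Nat.exists_eq_add_of_lt hkn
        calc (r (k + j + 1))⁻¹ ^ (k + j + 1) * r (k + j + 1) ^ k
            = (r (k + j + 1))⁻¹ * (r (k + j + 1))⁻¹ ^ j := by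
              generalize r (k + j + 1) = y at hrn
              simp only [inv_pow, pow_succ, pow_add]
              field_simp
          _ ≤ (r (k + j + 1))⁻¹ * 1 := by
              gcongr
              exact pow_le_one₀ (by positivity) (inv_le_one_of_one_le₀ (hr1 _))
          _ = _ := mul_one _
      have h3 : C n k ≤ ∑ k ∈ Finset.range n, C n k :=
        Finset.single_le_sum (fun k _ => hC0 n k) (Finset.mem_range.2 hkn)
      calc |c n| * (r n)⁻¹ ^ n * (r n ^ k * C n k)
          = ((r n)⁻¹ ^ n * r n ^ k) * (|c n| * C n k) := by ring
        _ ≤ (r n)⁻¹ * (|c n| * ∑ k ∈ Finset.range n, C n k) := by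
            have := hC0 n k
            gcongr
        _ ≤ (1 / 2) ^ n := by
            rw [inv_mul_le_iff₀ hrn, one_div, inv_pow, ← div_eq_mul_inv, le_div_iff₀ (by positivity)]
            simp only [hr]
            linarith
    · exact h1
  have hsum : ∀ k, Summable (v k) := fun k => by
    refine (summable_nat_add_iff (k + 1)).1 ?_
    have : (fun n => v k (n + (k + 1))) = fun n => (1 / 2 : ℝ) ^ (n + (k + 1)) := by
      funext n
      simp only [hv]
      rw [if_pos (by omega)]
    rw [this]
    exact (summable_nat_add_iff (k + 1)).2 summable_geometric_two
  have hF : ∀ (k n : ℕ) (t : ℝ), (k : ℕ∞) ≤ ⊤ → ‖iteratedFDeriv ℝ k (u n) t‖ ≤ v k n :=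
    fun k n t _ => by
      simpa [norm_iteratedFDeriv_eq_norm_iteratedDeriv] using hbound k n t
  refine ⟨fun t => ∑' n, u n t, contDiff_tsum hcd (fun k _ => hsum k) hF, fun k => ?_⟩
  have hs : Summable fun n => iteratedFDeriv ℝ k (u n) 0 :=
    Summable.of_norm_bounded (hsum k) fun n => hF k n 0 le_top
  rw [iteratedDeriv_eq_iteratedFDeriv, iteratedFDeriv_tsum_apply hcd (fun k _ => hsum k) hF le_top,
    ContinuousMultilinearMap.tsum_eval hs]
  simp_rw [← iteratedDeriv_eq_iteratedFDeriv, hder, mul_zero, hφ0]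
  rw [tsum_eq_single k fun n hn => by simp [hn.symm]]
  have := (hr0 k).ne'
  simp
  field_simp

theorem contDiff_of_forall_hasDerivAt_succ {φ : ℕ → ℝ → ℝ}
    (h : ∀ n x, HasDerivAt (φ n) (φ (n + 1) x) x) : ContDiff ℝ (⊤ : ℕ∞) (φ 0) := by
  refine contDiff_infty.2 fun k => ?_
  suffices H : ∀ k n : ℕ, ContDiff ℝ k (φ n) from H k 0
  intro k
  induction k with
  | zero =>
    intro n
    exact contDiff_zero.2 (continuous_iff_continuousAt.2 fun x => (h n x).continuousAt)
  | succ k ih =>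
    intro n
    have hd : deriv (φ n) = φ (n + 1) := funext fun x => (h n x).deriv
    push_cast
    refine contDiff_succ_iff_deriv.2 ⟨fun x => (h n x).differentiableAt, by simp, ?_⟩
    rw [hd]
    exact ih (n + 1)

theorem hasDerivAt_indicator_Icc {a b : ℝ} {h h' : ℝ → ℝ}
    (hd : ∀ x ∈ Icc a b, HasDerivWithinAt h (h' x) (Icc a b) x)
    (ha : h a = 0) (hb : h b = 0) (ha' : h' a = 0) (hb' : h' b = 0) (x : ℝ) :
    HasDerivAt ((Icc a b).indicator h) ((Icc a b).indicator h' x) x := by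
  by_cases hx : x ∈ Icc a b
  · rw [indicator_of_mem hx]
    have h1 : HasDerivWithinAt ((Icc a b).indicator h) (h' x) (Icc a b) x :=
      (hd x hx).congr (fun y hy => indicator_of_mem hy h) (indicator_of_mem hx h)
    by_cases hx' : x ∈ Ioo a b
    · exact h1.hasDerivAt (Icc_mem_nhds hx'.1 hx'.2)
    · have hx0 : h x = 0 ∧ h' x = 0 := by
        rcases hx.1.eq_or_lt with rfl | h2
        · exact ⟨ha, ha'⟩
        · rcases hx.2.eq_or_lt with rfl | h3
          · exact ⟨hb, hb'⟩
          · exact absurd ⟨h2, h3⟩ hx'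
      have h2 : HasDerivWithinAt ((Icc a b).indicator h) (h' x) (Icc a b)ᶜ x := by
        rw [hx0.2]
        refine (hasDerivWithinAt_const x (Icc a b)ᶜ (0 : ℝ)).congr
          (fun y hy => indicator_of_notMem hy h) ?_
        rw [indicator_of_mem hx, hx0.1]
      have h3 := h1.union h2
      rwa [union_compl_self, hasDerivWithinAt_univ] at h3
  · rw [indicator_of_notMem hx]
    refine (hasDerivAt_const x (0 : ℝ)).congr_of_eventuallyEq ?_
    filter_upwards [isClosed_Icc.isOpen_compl.mem_nhds hx] with y hy
    exact indicator_of_notMem hy h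

/-- A smooth function on `[a, b]` which is flat at both ends extends smoothly by zero. -/
theorem ContDiffOn.contDiff_indicator_Icc {a b : ℝ} (hab : a < b) {u : ℝ → ℝ}
    (hu : ContDiffOn ℝ (⊤ : ℕ∞) u (Icc a b))
    (ha : ∀ k, iteratedDerivWithin k u (Icc a b) a = 0)
    (hb : ∀ k, iteratedDerivWithin k u (Icc a b) b = 0) :
    ContDiff ℝ (⊤ : ℕ∞) ((Icc a b).indicator u) := by
  have := contDiff_of_forall_hasDerivAt_succ
    (φ := fun k => (Icc a b).indicator (iteratedDerivWithin k u (Icc a b))) fun k x =>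
      hasDerivAt_indicator_Icc (fun y hy => by
        rw [iteratedDerivWithin_succ]
        exact (hu.differentiableOn_iteratedDerivWithin (by exact_mod_cast ENat.natCast_lt_top k)
          (uniqueDiffOn_Icc hab) y hy).hasDerivWithinAt) (ha k) (hb k) (ha (k + 1)) (hb (k + 1)) x
  simpa using this

/-- A smooth function on a compact interval extends to a bounded smooth function on `ℝ`. -/
theorem ContDiffOn.exists_contDiff_bounded_eqOn_Icc {a b : ℝ} (hab : a < b) {w : ℝ → ℝ}
    (hw : ContDiffOn ℝ (⊤ : ℕ∞) w (Icc a b)) :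
    ∃ W : ℝ → ℝ, ContDiff ℝ (⊤ : ℕ∞) W ∧ EqOn W w (Icc a b) ∧ ∃ C, ∀ x, |W x| ≤ C := by
  obtain ⟨A, hA, hAa⟩ :=
    exists_contDiff_iteratedDeriv_eq (fun k => iteratedDerivWithin k w (Icc a b) a) a
  obtain ⟨B, hB, hBb⟩ :=
    exists_contDiff_iteratedDeriv_eq (fun k => iteratedDerivWithin k w (Icc a b) b) b
  set χ : ℝ → ℝ := fun t => Real.smoothTransition (3 * (t - a) / (b - a) - 1) with hχ
  have hχs : ContDiff ℝ (⊤ : ℕ∞) χ := Real.smoothTransition.contDiff.comp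
    (((contDiff_const.mul (contDiff_id.sub contDiff_const)).div_const _).sub contDiff_const)
  have hba : 0 < b - a := sub_pos.2 hab
  have hχa : ∀ᶠ t in nhds a, χ t = 0 := by
    filter_upwards [Iio_mem_nhds (show a < a + (b - a) / 3 by linarith)] with t ht
    refine Real.smoothTransition.zero_of_nonpos ?_
    rw [sub_nonpos, div_le_one hba]
    linarith [mem_Iio.1 ht]
  have hχb : ∀ᶠ t in nhds b, χ t = 1 := by
    filter_upwards [Ioi_mem_nhds (show b - (b - a) / 3 < b by linarith)] with t ht
    refine Real.smoothTransition.one_of_one_le ?_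
    rw [le_sub_iff_add_le, le_div_iff₀ hba]
    linarith [mem_Ioi.1 ht]
  set P : ℝ → ℝ := fun t => (1 - χ t) * A t + χ t * B t with hP
  have hPs : ContDiff ℝ (⊤ : ℕ∞) P := ((contDiff_const.sub hχs).mul hA).add (hχs.mul hB)
  have hPa : P =ᶠ[nhds a] A := hχa.mono fun t ht => by simp [hP, ht]
  have hPb : P =ᶠ[nhds b] B := hχb.mono fun t ht => by simp [hP, ht]
  have hud := uniqueDiffOn_Icc hab
  have hkey : ∀ x ∈ Icc a b, ∀ k, iteratedDeriv k P x = iteratedDerivWithin k w (Icc a b) x →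
      iteratedDerivWithin k (w - P) (Icc a b) x = 0 := fun x hx k h => by
    have hk : ((k : ℕ∞) : WithTop ℕ∞) ≤ ((⊤ : ℕ∞) : WithTop ℕ∞) := by exact_mod_cast le_top
    have hPk : ContDiff ℝ k P := hPs.of_le hk
    rw [iteratedDerivWithin_sub hx hud ((hw x hx).of_le hk) hPk.contDiffWithinAt,
      iteratedDerivWithin_eq_iteratedDeriv hud hPk.contDiffAt hx, h, sub_self]
  have hI := ContDiffOn.contDiff_indicator_Icc hab (hw.sub hPs.contDiffOn)
    (fun k => hkey a (left_mem_Icc.2 hab.le) k (by rw [hPa.iteratedDeriv_eq, hAa]))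
    (fun k => hkey b (right_mem_Icc.2 hab.le) k (by rw [hPb.iteratedDeriv_eq, hBb]))
  obtain ⟨R, hR⟩ : ∃ R, R = max |a| |b| := ⟨_, rfl⟩
  set η : ℝ → ℝ := fun t => Real.smoothTransition (R ^ 2 + 1 - t ^ 2) with hη
  have hηs : ContDiff ℝ (⊤ : ℕ∞) η :=
    Real.smoothTransition.contDiff.comp (contDiff_const.sub (contDiff_id.pow 2))
  have hη1 : ∀ t ∈ Icc a b, η t = 1 := fun t ht => by
    refine Real.smoothTransition.one_of_one_le ?_
    have : t ^ 2 ≤ R ^ 2 := by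
      rw [← sq_abs]
      exact pow_le_pow_left₀ (abs_nonneg t) (hR ▸ abs_le_max_abs_abs ht.1 ht.2) 2
    linarith
  have hηc : HasCompactSupport η := by
    refine HasCompactSupport.intro (isCompact_Icc (a := -(R ^ 2 + 1)) (b := R ^ 2 + 1))
      fun t ht => Real.smoothTransition.zero_of_nonpos ?_
    by_contra! h
    exact ht ⟨by nlinarith [sq_nonneg R], by nlinarith [sq_nonneg R]⟩
  have hWs := hηs.mul (hPs.add hI)
  obtain ⟨C, hC⟩ := hWs.continuous.bounded_above_of_compact_support hηc.mul_right
  refine ⟨_, hWs, fun x hx => ?_, C, hC⟩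
  simp [hη1 x hx, indicator_of_mem hx]

theorem ContDiff.exists_hasDerivAt_eq {v : ℝ → ℝ} (hv : ContDiff ℝ (⊤ : ℕ∞) v) (x₀ y₀ : ℝ) :
    ∃ T : ℝ → ℝ, ContDiff ℝ (⊤ : ℕ∞) T ∧ T x₀ = y₀ ∧ ∀ x, HasDerivAt T (v x) x := by
  have hd : ∀ x, HasDerivAt (fun x => y₀ + ∫ t in x₀..x, v t) (v x) x := fun x =>
    (hv.continuous.integral_hasStrictDerivAt x₀ x).hasDerivAt.const_add y₀
  refine ⟨_, ?_, by simp, hd⟩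
  refine contDiff_infty_iff_deriv.2 ⟨fun x => (hd x).differentiableAt, ?_⟩
  rwa [funext fun x => (hd x).deriv]

/-- A smooth function whose derivative is bounded below by a positive constant has a smooth
inverse. -/
theorem ContDiff.exists_inverse_of_le_deriv {T v : ℝ → ℝ} {c : ℝ} (hT : ContDiff ℝ (⊤ : ℕ∞) T)
    (hd : ∀ x, HasDerivAt T (v x) x) (hc : 0 < c) (hv : ∀ x, c ≤ v x) :
    ∃ g : ℝ → ℝ, ContDiff ℝ (⊤ : ℕ∞) g ∧ (∀ x, g (T x) = x) ∧ (∀ y, T (g y) = y) ∧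
      StrictMono T := by
  have hmono : StrictMono T := strictMono_of_deriv_pos fun x => by
    rw [(hd x).deriv]
    exact hc.trans_le (hv x)
  have hlin : Monotone fun x => T x - c * x := by
    have hd' : ∀ x, HasDerivAt (fun x => T x - c * x) (v x - c) x := fun x => by
      have h := (hd x).sub ((hasDerivAt_id x).const_mul c)
      rwa [mul_one] at h
    refine monotone_of_deriv_nonneg (fun x => (hd' x).differentiableAt) fun x => ?_
    rw [(hd' x).deriv]
    exact sub_nonneg.2 (hv x)
  have hsurj : Function.Surjective T := by
    refine hT.continuous.surjective ?_ ?_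
    · refine Filter.tendsto_atTop_mono' _ (f₁ := fun x => T 0 + c * x) ?_
        (Filter.tendsto_atTop_add_const_left _ _ (Filter.tendsto_id.const_mul_atTop hc))
      filter_upwards [Filter.eventually_ge_atTop 0] with x hx
      have := hlin hx
      simp only [mul_zero, sub_zero] at this
      linarith
    · refine Filter.tendsto_atBot_mono' _ (f₁ := fun x => T 0 + c * x) ?_
        (Filter.tendsto_atBot_add_const_left _ _ (Filter.tendsto_id.const_mul_atBot hc))
      filter_upwards [Filter.eventually_le_atBot 0] with x hx
      have := hlin hx
      simp only [mul_zero, sub_zero] at this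
      linarith
  let e := (hmono.orderIsoOfSurjective T hsurj).toHomeomorph
  refine ⟨e.symm, ?_, fun x => e.symm_apply_apply x, fun y => e.apply_symm_apply y, hmono⟩
  exact e.contDiff_symm_deriv (f' := v) (fun x => (hc.trans_le (hv x)).ne') hd hT

theorem ContDiff.derivWithin_derivWithin_of_eqOn {f g : ℝ → ℝ} {S : Set ℝ}
    (hg : ContDiff ℝ (⊤ : ℕ∞) g) (hS : UniqueDiffOn ℝ S) (h : EqOn f g S) {s : ℝ} (hs : s ∈ S) :
    derivWithin f S s = deriv g s ∧
      derivWithin (derivWithin f S) S s = deriv (deriv g) s := by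
  have hg' : ContDiff ℝ (⊤ : ℕ∞) (deriv g) := (contDiff_infty_iff_deriv.1 hg).2
  have h1 : EqOn (derivWithin f S) (deriv g) S := fun t ht => by
    rw [derivWithin_congr h (h ht)]
    exact (hg.differentiable (by simp) t).derivWithin (hS t ht)
  refine ⟨h1 hs, ?_⟩
  rw [derivWithin_congr h1 (h1 hs)]
  exact (hg'.differentiable (by simp) s).derivWithin (hS s hs)

/-- If `g'` squared equals `p ∘ g`, then `g'' = p' (g) / 2` wherever `g' ≠ 0`. -/
theorem deriv_comp_eq_two_mul_deriv {g v p : ℝ → ℝ} {s : ℝ} (hg : HasDerivAt g (v s) s)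
    (hv : DifferentiableAt ℝ v s) (hp : DifferentiableAt ℝ p (g s))
    (h : ∀ t, v t ^ 2 = p (g t)) (h0 : v s ≠ 0) :
    deriv p (g s) = 2 * deriv v s := by
  have h1 := hp.hasDerivAt.comp s hg
  have h2 := hv.hasDerivAt.pow 2
  rw [show v ^ 2 = p ∘ g from funext h] at h2
  have h3 := h1.unique h2
  simp at h3
  refine mul_right_cancel₀ h0 ?_
  linarith

/-- The squared profile speed `q`, as a function of the area radius, can be modified beyond the
radius `r` so that the charged dominant energy condition persists and `q` eventually becomes the
Reissner–Nordström one. -/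
theorem exists_radial_speed_extension {Q r m C : ℝ} {q : ℝ → ℝ} (hq : ContDiff ℝ (⊤ : ℕ∞) q)
    (hq0 : ∀ x, 0 < q x) (hqC : ∀ x, q x ≤ C) (hr : |Q| < r)
    (hM : |Q| ≤ r / 2 * (1 + Q ^ 2 / r ^ 2 - q r))
    (hm : r / 2 * (1 + Q ^ 2 / r ^ 2 - q r) < m)
    (hdec : 0 < 1 - q r - Q ^ 2 / r ^ 2 - r * deriv q r) :
    ∃ p : ℝ → ℝ, ContDiff ℝ (⊤ : ℕ∞) p ∧ (∀ x, 0 < p x) ∧ (∃ D, ∀ x, p x ≤ D) ∧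
      (∀ x ≤ r, p x = q x) ∧ (∀ x, r ≤ x → 0 ≤ 1 - p x - Q ^ 2 / x ^ 2 - x * deriv p x) ∧
      ∃ X, ∀ x, X ≤ x → m + Real.sqrt (m ^ 2 - Q ^ 2) < x ∧
        p x = 1 - 2 * m / x + Q ^ 2 / x ^ 2 := by
  have hr0 : 0 < r := (abs_nonneg Q).trans_lt hr
  have hm0 : 0 < m := (abs_nonneg Q).trans_lt (hM.trans_lt hm)
  obtain ⟨m₀, hm₀, hm₀'⟩ : ∃ m₀, r / 2 * (1 + Q ^ 2 / r ^ 2 - q r) < m₀ ∧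
      m₀ < min m (r / 2 * (1 + Q ^ 2 / r ^ 2)) := by
    refine exists_between (lt_min hm ?_)
    have := mul_pos (half_pos hr0) (hq0 r)
    linarith
  obtain ⟨hm₀m, hm₀h⟩ := lt_min_iff.1 hm₀'
  have hm₀0 : 0 ≤ m₀ := (abs_nonneg Q).trans (hM.trans hm₀.le)
  have hqd : ContDiff ℝ (⊤ : ℕ∞) (deriv q) := (contDiff_infty_iff_deriv.1 hq).2
  obtain ⟨δ, hδ, hδ'⟩ : ∃ δ > 0, ∀ x, r ≤ x → x ≤ r + δ →
      0 < 1 - q x - Q ^ 2 / x ^ 2 - x * deriv q x ∧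
      1 + Q ^ 2 / x ^ 2 - 2 * m₀ / x < q x := by
    have hc : ContinuousAt (fun x => Q ^ 2 / x ^ 2) r :=
      continuousAt_const.div (continuousAt_id.pow 2) (by positivity)
    have c1 : ContinuousAt (fun x => 1 - q x - Q ^ 2 / x ^ 2 - x * deriv q x) r :=
      ((continuousAt_const.sub hq.continuous.continuousAt).sub hc).sub
        (continuousAt_id.mul hqd.continuous.continuousAt)
    have c2 : ContinuousAt (fun x => 1 + Q ^ 2 / x ^ 2 - 2 * m₀ / x) r :=
      (continuousAt_const.add hc).sub (continuousAt_const.div continuousAt_id hr0.ne')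
    have h2 : 1 + Q ^ 2 / r ^ 2 - 2 * m₀ / r < q r := by
      rw [sub_lt_comm, lt_div_iff₀ hr0]
      linarith
    obtain ⟨ε, hε, h⟩ := Metric.eventually_nhds_iff.1
      ((c1.eventually (lt_mem_nhds hdec)).and (c2.eventually_lt hq.continuous.continuousAt h2))
    refine ⟨ε / 2, half_pos hε, fun x hx hx' => h ?_⟩
    rw [Real.dist_eq, abs_of_nonneg (sub_nonneg.2 hx)]
    linarith
  set χ : ℝ → ℝ := fun x => Real.smoothTransition ((x - r) / δ) with hχ
  set μ : ℝ → ℝ := fun x => m₀ + Real.smoothTransition (x - (2 * m + r)) * (m - m₀) with hμ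
  have hχs : ContDiff ℝ (⊤ : ℕ∞) χ :=
    Real.smoothTransition.contDiff.comp ((contDiff_id.sub contDiff_const).div_const _)
  have hμs : ContDiff ℝ (⊤ : ℕ∞) μ := contDiff_const.add
    ((Real.smoothTransition.contDiff.comp (contDiff_id.sub contDiff_const)).mul contDiff_const)
  have hχmono : Monotone χ := fun x y hxy => Real.smoothTransition.monotone (by gcongr)
  have hμmono : Monotone μ := fun x y hxy => by
    have h1 := sub_nonneg.2 hm₀m.le
    have h2 : Real.smoothTransition (x - (2 * m + r)) ≤ Real.smoothTransition (y - (2 * m + r)) :=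
      Real.smoothTransition.monotone (by gcongr)
    simp only [hμ]
    gcongr
  have hχ0 : ∀ x ≤ r, χ x = 0 := fun x hx =>
    Real.smoothTransition.zero_of_nonpos (div_nonpos_of_nonpos_of_nonneg (by linarith) hδ.le)
  have hχ1 : ∀ x, r + δ ≤ x → χ x = 1 := fun x hx =>
    Real.smoothTransition.one_of_one_le ((one_le_div hδ).2 (by linarith))
  have hμ₀ : ∀ x, m₀ ≤ μ x := fun x =>
    le_add_of_nonneg_right (mul_nonneg (Real.smoothTransition.nonneg _) (sub_nonneg.2 hm₀m.le))
  have hμm : ∀ x, μ x ≤ m := fun x => by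
    have := mul_le_mul_of_nonneg_right (Real.smoothTransition.le_one (x - (2 * m + r)))
      (sub_nonneg.2 hm₀m.le)
    simp only [hμ]
    linarith
  set ρ : ℝ → ℝ := fun x => 1 + Q ^ 2 / x ^ 2 - 2 * μ x / x with hρ
  have hρ0 : ∀ x, r ≤ x → 0 < ρ x := fun x hx => by
    have hx0 : 0 < x := hr0.trans_le hx
    have key : 2 * μ x * x < x ^ 2 + Q ^ 2 := by
      rcases le_total x (2 * m + r) with h | h
      · have hμx : μ x = m₀ := by
          simp [hμ, Real.smoothTransition.zero_of_nonpos (sub_nonpos.2 h)]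
        have h1 : 2 * m₀ * r < r ^ 2 + Q ^ 2 := by
          have : r / 2 * (1 + Q ^ 2 / r ^ 2) = (r ^ 2 + Q ^ 2) / (2 * r) := by field_simp
          rw [this, lt_div_iff₀ (by positivity)] at hm₀h
          linarith
        have hQ : Q ^ 2 < r ^ 2 := by
          rw [← sq_abs Q]
          exact pow_lt_pow_left₀ hr (abs_nonneg Q) two_ne_zero
        rw [hμx]
        have h2 : 0 ≤ (x - r) * (x * r - Q ^ 2) := mul_nonneg (sub_nonneg.2 hx) (by nlinarith)
        have h3 := mul_lt_mul_of_pos_right h1 hx0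
        refine lt_of_mul_lt_mul_right ?_ hr0.le
        nlinarith
      · have := mul_le_mul_of_nonneg_right (hμm x) hx0.le
        nlinarith [sq_nonneg Q]
    have : ρ x = (x ^ 2 + Q ^ 2 - 2 * μ x * x) / x ^ 2 := by
      simp only [hρ]
      field_simp
    rw [this]
    exact div_pos (by linarith) (by positivity)
  have hρs : ∀ x, 0 < x → ContDiffAt ℝ (⊤ : ℕ∞) ρ x := fun x hx =>
    (contDiffAt_const.add (contDiffAt_const.div (contDiffAt_id.pow 2) (by positivity))).sub
      ((contDiffAt_const.mul hμs.contDiffAt).div contDiffAt_id hx.ne')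
  set p : ℝ → ℝ := fun x => (1 - χ x) * q x + χ x * ρ x with hp
  have hpq : ∀ x ≤ r, p x = q x := fun x hx => by simp [hp, hχ0 x hx]
  have hχle : ∀ x, 0 ≤ 1 - χ x := fun x => sub_nonneg.2 (Real.smoothTransition.le_one _)
  have hχnn : ∀ x, 0 ≤ χ x := fun x => Real.smoothTransition.nonneg _
  refine ⟨p, contDiff_iff_contDiffAt.2 fun x => ?_, fun x => ?_, ⟨max C 2, fun x => ?_⟩, hpq,
    fun x hx => ?_, max (r + δ) (2 * m + r + 1), fun x hx => ?_⟩
  · rcases lt_or_ge x r with hx | hx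
    · refine hq.contDiffAt.congr_of_eventuallyEq ?_
      filter_upwards [Iio_mem_nhds hx] with y hy using hpq y (le_of_lt hy)
    · exact ((contDiff_const.sub hχs).mul hq).contDiffAt.add
        (hχs.contDiffAt.mul (hρs x (hr0.trans_le hx)))
  · rcases lt_or_ge x r with hx | hx
    · rw [hpq x hx.le]
      exact hq0 x
    · rcases (hχnn x).eq_or_lt with h | h
      · simpa [hp, ← h] using hq0 x
      · exact add_pos_of_nonneg_of_pos (mul_nonneg (hχle x) (hq0 x).le) (mul_pos h (hρ0 x hx))
  · rcases lt_or_ge x r with hx | hx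
    · rw [hpq x hx.le]
      exact (hqC x).trans (le_max_left _ _)
    · have hx0 : 0 < x := hr0.trans_le hx
      have h1 : ρ x ≤ 2 := by
        have h2 : Q ^ 2 / x ^ 2 ≤ 1 := by
          rw [div_le_one (by positivity), ← sq_abs Q]
          exact pow_le_pow_left₀ (abs_nonneg Q) (hr.le.trans hx) 2
        have h3 : 0 ≤ 2 * μ x / x :=
          div_nonneg (mul_nonneg zero_le_two (hm₀0.trans (hμ₀ x))) hx0.le
        simp only [hρ]
        linarith
      calc p x ≤ (1 - χ x) * max C 2 + χ x * max C 2 :=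
            add_le_add (mul_le_mul_of_nonneg_left ((hqC x).trans (le_max_left _ _)) (hχle x))
              (mul_le_mul_of_nonneg_left (h1.trans (le_max_right _ _)) (hχnn x))
        _ = max C 2 := by ring
  · have hx0 : 0 < x := hr0.trans_le hx
    have dχ := (hχs.differentiable (by simp) x).hasDerivAt
    have dμ := (hμs.differentiable (by simp) x).hasDerivAt
    have dq := (hq.differentiable (by simp) x).hasDerivAt
    have dρ := ((hρs x hx0).differentiableAt (by simp)).hasDerivAt
    have hρ' : x * deriv ρ x = 1 - ρ x - Q ^ 2 / x ^ 2 - 2 * deriv μ x := by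
      have h := (((hasDerivAt_const x (Q ^ 2)).div ((hasDerivAt_id x).pow 2)
        (pow_ne_zero 2 hx0.ne')).const_add 1).sub
        ((dμ.const_mul 2).div (hasDerivAt_id x) hx0.ne')
      have h' : deriv ρ x = _ := h.deriv
      rw [h']
      simp [hρ]
      field_simp
      ring
    have hp' : deriv p x
        = -deriv χ x * q x + (1 - χ x) * deriv q x + (deriv χ x * ρ x + χ x * deriv ρ x) :=
      (((dχ.const_sub 1).mul dq).add (dχ.mul dρ)).deriv
    have e : 1 - p x - Q ^ 2 / x ^ 2 - x * deriv p x
        = (1 - χ x) * (1 - q x - Q ^ 2 / x ^ 2 - x * deriv q x) + χ x * (2 * deriv μ x)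
          + x * (deriv χ x * (q x - ρ x)) := by
      rw [hp']
      simp only [hp]
      linear_combination -χ x * hρ'
    have hχ' : 0 ≤ deriv χ x := hχmono.deriv_nonneg
    have hμ' : 0 ≤ deriv μ x := hμmono.deriv_nonneg
    have t1 : 0 ≤ (1 - χ x) * (1 - q x - Q ^ 2 / x ^ 2 - x * deriv q x) := by
      rcases le_total x (r + δ) with h | h
      · exact mul_nonneg (hχle x) (hδ' x hx h).1.le
      · simp [hχ1 x h]
    have t2 : 0 ≤ deriv χ x * (q x - ρ x) := by
      rcases le_or_gt x (r + δ) with h | h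
      · refine mul_nonneg hχ' (sub_nonneg.2 (le_trans ?_ (hδ' x hx h).2.le))
        simp only [hρ]
        have := hμ₀ x
        gcongr
      · have hc : χ =ᶠ[nhds x] fun _ => 1 := by
          filter_upwards [Ioi_mem_nhds h] with y hy using hχ1 y (le_of_lt hy)
        simp [hc.deriv_eq]
    rw [e]
    have := hχnn x
    positivity
  · have h1 : r + δ ≤ x := (le_max_left _ _).trans hx
    have h2 : 2 * m + r + 1 ≤ x := (le_max_right _ _).trans hx
    refine ⟨?_, ?_⟩
    · have : Real.sqrt (m ^ 2 - Q ^ 2) ≤ m :=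
        Real.sqrt_le_iff.2 ⟨hm0.le, by linarith [sq_nonneg Q]⟩
      linarith
    · have hμx : μ x = m := by
        simp [hμ, Real.smoothTransition.one_of_one_le (show 1 ≤ x - (2 * m + r) by linarith)]
      simp only [hp, hρ, hχ1 x h1, hμx]
      ring

/-- Gluing to a Reissner–Nordström manifold (radial profile form): a smooth increasing
positive profile satisfying the charged dominant energy condition
(`1 - f'^2 - 2 f f'' > Q^2/f^2`), whose boundary radius exceeds `|Q|` and whose
boundary charged Hawking mass is at least `|Q|`, can be smoothly extended to `[a,∞)`
keeping the charged dominant energy condition, eventually coinciding with the exterior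
sub-extremal Reissner–Nordström profile of any mass `m` exceeding the boundary charged
Hawking mass (such `m` automatically satisfies `m > |Q|`). -/
theorem gluing_to_ReissnerNordstrom
    (Q : ℝ) (a b : ℝ) (hab : a < b) (f : ℝ → ℝ)
    (hf : ContDiffOn ℝ (⊤ : ℕ∞) f (Icc a b))
    (hpos : ∀ s ∈ Icc a b, 0 < f s ∧ 0 < derivWithin f (Icc a b) s)
    (hscal : ∀ s ∈ Icc a b,
      Q ^ 2 / (f s) ^ 2 < 1 - (derivWithin f (Icc a b) s) ^ 2
        - 2 * f s * derivWithin (derivWithin f (Icc a b)) (Icc a b) s)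
    (hb : |Q| < f b)
    (hHawking : |Q| ≤ f b / 2 * (1 + Q ^ 2 / (f b) ^ 2 - (derivWithin f (Icc a b) b) ^ 2)) :
    ∀ m : ℝ, f b / 2 * (1 + Q ^ 2 / (f b) ^ 2 - (derivWithin f (Icc a b) b) ^ 2) < m →
    |Q| < m ∧
    ∃ c : ℝ, b < c ∧ ∃ g : ℝ → ℝ, ContDiffOn ℝ (⊤ : ℕ∞) g (Ici a) ∧
      (∀ s ∈ Icc a b, g s = f s) ∧
      (∀ s ∈ Ici a, 0 < g s ∧ 0 < derivWithin g (Ici a) s) ∧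
      (∀ s ∈ Ici a,
        Q ^ 2 / (g s) ^ 2 ≤ 1 - (derivWithin g (Ici a) s) ^ 2
          - 2 * g s * derivWithin (derivWithin g (Ici a)) (Ici a) s) ∧
      (∀ s : ℝ, c ≤ s → m + Real.sqrt (m ^ 2 - Q ^ 2) < g s ∧
        derivWithin g (Ici a) s
          = Real.sqrt (1 - 2 * m / g s + Q ^ 2 / (g s) ^ 2)) := by
  intro m hm
  refine ⟨hHawking.trans_lt hm, ?_⟩
  have hud := uniqueDiffOn_Icc hab
  have hbmem : b ∈ Icc a b := right_mem_Icc.2 hab.le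
  obtain ⟨W, hW, hWf, K, hK⟩ := ContDiffOn.exists_contDiff_bounded_eqOn_Icc hab
    ((hf.derivWithin hud (m := (⊤ : ℕ∞)) (by simp)).log fun s hs => (hpos s hs).2.ne')
  set V : ℝ → ℝ := fun s => Real.exp (W s) with hVdef
  have hV : ContDiff ℝ (⊤ : ℕ∞) V := hW.exp
  have hV0 : ∀ s, 0 < V s := fun s => Real.exp_pos _
  have hVlo : ∀ s, Real.exp (-K) ≤ V s := fun s => Real.exp_le_exp.2 (abs_le.1 (hK s)).1
  have hVhi : ∀ s, V s ≤ Real.exp K := fun s => Real.exp_le_exp.2 (abs_le.1 (hK s)).2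
  have hVf : ∀ s ∈ Icc a b, V s = derivWithin f (Icc a b) s := fun s hs => by
    simp only [hVdef]
    rw [hWf hs, Real.exp_log (hpos s hs).2]
  -- a global smooth increasing diffeomorphism `F` extending `f`
  obtain ⟨F, hF, hFa, hFd⟩ := hV.exists_hasDerivAt_eq a (f a)
  have hfF : EqOn f F (Icc a b) := by
    have hd : ∀ s ∈ Icc a b, HasDerivWithinAt (fun s => f s - F s) 0 (Icc a b) s := fun s hs => by
      have h := (hf.differentiableOn (by simp) s hs).hasDerivWithinAt.sub (hFd s).hasDerivWithinAt
      rwa [hVf s hs, sub_self] at h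
    intro s hs
    have := constant_of_derivWithin_zero (fun s hs => (hd s hs).differentiableWithinAt)
      (fun s hs => (hd s (Ico_subset_Icc_self hs)).derivWithin (hud s (Ico_subset_Icc_self hs))) s hs
    simpa [hFa, sub_eq_zero] using this
  have hFderiv : deriv F = V := funext fun s => (hFd s).deriv
  obtain ⟨τ, hτ, hτF, -, hFmono⟩ := hF.exists_inverse_of_le_deriv hFd (Real.exp_pos _) hVlo
  set q : ℝ → ℝ := fun x => V (τ x) ^ 2 with hqdef
  have hq : ContDiff ℝ (⊤ : ℕ∞) q := (hV.comp hτ).pow 2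
  have hqF : ∀ s, V s ^ 2 = q (F s) := fun s => by simp only [hqdef, hτF]
  have hFb : f b = F b := hfF hbmem
  have hVb : derivWithin f (Icc a b) b = V b := (hVf b hbmem).symm
  have hb2 := (hF.derivWithin_derivWithin_of_eqOn hud hfF hbmem).2
  have hq' := deriv_comp_eq_two_mul_deriv (hFd b) (hV.differentiable (by simp) b)
    (hq.differentiable (by simp) _) hqF (hV0 b).ne'
  have hsb := hscal b hbmem
  rw [hb2, hFderiv, hVb, hFb, hqF] at hsb
  rw [hFb, hVb, hqF] at hm hHawking
  rw [hFb] at hb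
  -- the squared speed, as a function of the radius, and the associated profile
  obtain ⟨p, hp, hp0, ⟨D, hD⟩, hpq, hpdec, X, hX⟩ := exists_radial_speed_extension hq
    (fun x => pow_pos (hV0 _) 2) (C := Real.exp K ^ 2)
    (fun x => pow_le_pow_left₀ (hV0 _).le (hVhi _) 2) hb hHawking hm
    (by rw [hq']; linarith)
  set S : ℝ → ℝ := fun x => Real.sqrt (p x) with hSdef
  have hS : ContDiff ℝ (⊤ : ℕ∞) S := hp.sqrt fun x => (hp0 x).ne'
  have hS0 : ∀ x, 0 < S x := fun x => Real.sqrt_pos.2 (hp0 x)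
  have hSinv : ContDiff ℝ (⊤ : ℕ∞) fun x => (S x)⁻¹ := hS.inv fun x => (hS0 x).ne'
  obtain ⟨T, hT, hTb, hTd⟩ := hSinv.exists_hasDerivAt_eq (F b) b
  obtain ⟨g, hg, hgT, hTg, -⟩ := hT.exists_inverse_of_le_deriv hTd
    (c := (Real.sqrt D)⁻¹)
    (inv_pos.2 (Real.sqrt_pos.2 ((hp0 0).trans_le (hD 0))))
    fun x => inv_anti₀ (hS0 x) (Real.sqrt_le_sqrt (hD x))
  have hgd : ∀ s, HasDerivAt g (S (g s)) s := fun s => by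
    have h1 := (hg.differentiable (by simp) s).hasDerivAt
    have h2 := (hTd (g s)).comp s h1
    rw [show T ∘ g = id from funext hTg] at h2
    have h3 := h2.unique (hasDerivAt_id s)
    rw [inv_mul_eq_one₀ (hS0 _).ne'] at h3
    rwa [h3]
  have hgderiv : deriv g = fun s => S (g s) := funext fun s => (hgd s).deriv
  have hgmono : StrictMono g := strictMono_of_deriv_pos fun s => by
    rw [hgderiv]
    exact hS0 _
  have hgF : ∀ s ≤ b, g s = F s := by
    have hd : ∀ t ≤ b, HasDerivAt (fun t => T (F t) - t) 0 t := fun t ht => by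
      have h := ((hTd (F t)).comp t (hFd t)).sub (hasDerivAt_id t)
      have hSV : S (F t) = V t := by
        simp only [hSdef]
        rw [hpq _ (hFmono.monotone ht), ← hqF, Real.sqrt_sq (hV0 t).le]
      rwa [hSV, inv_mul_cancel₀ (hV0 t).ne', sub_self] at h
    intro s hs
    have h := constant_of_has_deriv_right_zero (f := fun t => T (F t) - t) (a := s) (b := b)
      (fun t ht => (hd t ht.2).continuousAt.continuousWithinAt)
      (fun t ht => (hd t ht.2.le).hasDerivWithinAt) b (right_mem_Icc.2 hs)
    simp only [hTb, sub_self] at h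
    have hF' := hgT (F s)
    rwa [sub_eq_zero.1 h.symm] at hF'
  have hgf : ∀ s ∈ Icc a b, g s = f s := fun s hs => (hgF s hs.2).trans (hfF hs).symm
  have hgIci := fun s (hs : s ∈ Ici a) =>
    hg.derivWithin_derivWithin_of_eqOn (uniqueDiffOn_Ici a) (eqOn_refl g _) hs
  refine ⟨max (T X) (b + 1), lt_max_of_lt_right (lt_add_one b), g, hg.contDiffOn, hgf,
    fun s hs => ⟨?_, ?_⟩, fun s hs => ?_, fun s hs => ?_⟩
  · have ham := left_mem_Icc.2 hab.le
    exact (hgf a ham ▸ (hpos a ham).1).trans_le (hgmono.monotone hs)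
  · rw [(hgIci s hs).1, hgderiv]
    exact hS0 _
  · rw [(hgIci s hs).1, (hgIci s hs).2]
    rcases le_total s b with h | h
    · have hsm : s ∈ Icc a b := ⟨hs, h⟩
      have h1 := hg.derivWithin_derivWithin_of_eqOn hud (fun t ht => (hgf t ht).symm) hsm
      rw [← h1.1, ← h1.2, hgf s hsm]
      exact (hscal s hsm).le
    · have hsq : ∀ t, S (g t) ^ 2 = p (g t) := fun t => Real.sq_sqrt (hp0 _).le
      have h1 := deriv_comp_eq_two_mul_deriv (hgd s) ((hS.comp hg).differentiable (by simp) s)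
        (hp.differentiable (by simp) _) hsq (hS0 _).ne'
      have h2 := hpdec (g s) (hgF b le_rfl ▸ hgmono.monotone h)
      rw [h1] at h2
      rw [hgderiv, hsq]
      simp only [Function.comp_def] at h2
      linarith
  · have hsa : a ≤ s := by linarith [(le_max_right _ _).trans hs]
    have hsX : X ≤ g s := by
      rw [← hgT X]
      exact hgmono.monotone ((le_max_left _ _).trans hs)
    rw [(hgIci s hsa).1, hgderiv, ← (hX _ hsX).2]
    exact ⟨(hX _ hsX).1, rfl⟩
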